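/- arXiv:1805.11153 — 2 statements merged into one kernel-verified Lean document; each statement's English description precedes it below -/
import Mathlib

section
/- Fix k ≥ 3 and let p : ℕ → (0,1) be a sequence with n·p(n)⁴ → 0 as n → ∞. Suppose that the sequence 2·log n − log k − n·p(n)²·(1 − 1/k) − log 2 + log(1 + (k−1)·e^{n·p(n)²/k}) converges to some real number c with c < 0. Then for every ε > 0 there exists N such that for all n ≥ N, the probability P_k^t(n,p(n)) that a random Turán k-partite graph on n vertices with edge probability p(n) has diameter at most 2 satisfies P_k^t(n,p(n)) ≥ 1 − (1+ε)·e^{c}. -/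
open scoped Classical

/-- The number of unordered pairs of vertices lying in two different partite sets, for a
`k`-partite vertex set with part sizes `sz 0, …, sz (k-1)`. -/
def crossPairs (k : ℕ) (sz : Fin k → ℕ) : ℕ :=
  ∑ i : Fin k, ∑ j : Fin k, if i < j then sz i * sz j else 0

/-- The probability that a random `k`-partite graph — with partite sets of sizes
`sz 0, …, sz (k-1)`, in which each pair of vertices lying in two different partite sets
is joined by an edge independently with probability `p` — is connected with diameter at
most `2`. -/
noncomputable def kpartiteDiam2Prob (k : ℕ) (sz : Fin k → ℕ) (p : ℝ) : ℝ :=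
  ∑ G : SimpleGraph (Σ i : Fin k, Fin (sz i)),
    if (∀ u v : (Σ i : Fin k, Fin (sz i)), G.Adj u v → u.1 ≠ v.1) ∧
        G.Connected ∧ ∀ u v : (Σ i : Fin k, Fin (sz i)), G.dist u v ≤ 2 then
      p ^ Nat.card G.edgeSet * (1 - p) ^ (crossPairs k sz - Nat.card G.edgeSet)
    else 0

/-- The Turán partition of `n` vertices into `k` parts: the part sizes are as equal as
possible, each being `⌊n/k⌋` or `⌈n/k⌉`. -/
def turanSizes (k n : ℕ) : Fin k → ℕ :=
  fun i => if (i : ℕ) < n % k then n / k + 1 else n / k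

/-- The probability that a random Turán `k`-partite graph on `n` vertices with edge
probability `p` is connected with diameter at most `2`. -/
noncomputable def turanKpartiteDiam2Prob (k n : ℕ) (p : ℝ) : ℝ :=
  kpartiteDiam2Prob k (turanSizes k n) p

/-- The expectation of `f S`, where `S` is a random subset of `E` containing each element
independently with probability `p`. -/
def bernoulliSum {α : Type*} (p : ℝ) (E : Finset α) (f : Finset α → ℝ) : ℝ :=
  ∑ S ∈ E.powerset, p ^ S.card * (1 - p) ^ (E.card - S.card) * f S

theorem bernoulliSum_one {α : Type*} (p : ℝ) (E : Finset α) :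
    bernoulliSum p E (fun _ => 1) = 1 := by
  simp [bernoulliSum, Finset.sum_pow_mul_eq_add_pow]

theorem bernoulliSum_mono {α : Type*} {p : ℝ} (hp : p ∈ Set.Ioo (0 : ℝ) 1) (E : Finset α)
    {f g : Finset α → ℝ} (h : ∀ S ⊆ E, f S ≤ g S) : bernoulliSum p E f ≤ bernoulliSum p E g := by
  have h0 := hp.1
  have h1 : 0 < 1 - p := sub_pos.2 hp.2
  refine Finset.sum_le_sum fun S hS => ?_
  exact mul_le_mul_of_nonneg_left (h S (Finset.mem_powerset.1 hS)) (by positivity)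

theorem bernoulliSum_insert {α : Type*} [DecidableEq α] (p : ℝ) {E : Finset α} {e : α}
    (he : e ∉ E) (f : Finset α → ℝ) :
    bernoulliSum p (insert e E) f =
      (1 - p) * bernoulliSum p E f + p * bernoulliSum p E (fun S => f (insert e S)) := by
  unfold bernoulliSum
  rw [Finset.sum_powerset_insert he, Finset.mul_sum, Finset.mul_sum]
  congr 1 <;> refine Finset.sum_congr rfl fun S hS => ?_ <;>
    have hSE := Finset.mem_powerset.1 hS <;> have hc := Finset.card_le_card hSE
  · rw [Finset.card_insert_of_notMem he, Nat.sub_add_comm hc, pow_succ]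
    ring
  · rw [Finset.card_insert_of_notMem he, Finset.card_insert_of_notMem (fun h => he (hSE h)),
      Nat.add_sub_add_right, pow_succ]
    ring

/-- The indicator of the event that `S` contains none of the pairs `{a w, b w}`, `w ∈ W`. -/
noncomputable def avoidsPairs {α ι : Type*} (a b : ι → α) (W : Finset ι) (S : Finset α) : ℝ :=
  if ∀ w ∈ W, ¬(a w ∈ S ∧ b w ∈ S) then 1 else 0

theorem avoidsPairs_congr {α ι κ : Type*} {a b : ι → α} {a' b' : κ → α} {W : Finset ι}
    {W' : Finset κ} {S S' : Finset α}
    (h : (∀ w ∈ W, ¬(a w ∈ S ∧ b w ∈ S)) ↔ ∀ w ∈ W', ¬(a' w ∈ S' ∧ b' w ∈ S')) :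
    avoidsPairs a b W S = avoidsPairs a' b' W' S' := by
  unfold avoidsPairs
  by_cases h1 : ∀ w ∈ W, ¬(a w ∈ S ∧ b w ∈ S)
  · rw [if_pos h1, if_pos (h.1 h1)]
  · rw [if_neg h1, if_neg (mt h.2 h1)]

/-- The probability that a random set contains none of the disjoint pairs `{a w, b w}`. -/
theorem bernoulliSum_avoidsPairs {α ι : Type*} [DecidableEq α] (p : ℝ) (a b : ι → α)
    (W : Finset ι) (E : Finset α) (ha : ∀ w ∈ W, a w ∈ E) (hb : ∀ w ∈ W, b w ∈ E)
    (hab : ∀ w ∈ W, ∀ w' ∈ W, a w ≠ b w') (haa : ∀ w ∈ W, ∀ w' ∈ W, a w = a w' → w = w')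
    (hbb : ∀ w ∈ W, ∀ w' ∈ W, b w = b w' → w = w') :
    bernoulliSum p E (avoidsPairs a b W) = (1 - p ^ 2) ^ W.card := by
  induction W using Finset.induction_on generalizing E with
  | empty =>
    have h : avoidsPairs a b ∅ = fun _ => 1 := by
      ext S
      simp [avoidsPairs]
    rw [h, bernoulliSum_one, Finset.card_empty, pow_zero]
  | insert w W hw ih =>
    have hne : ∀ x ∈ W, a x ≠ a w ∧ b x ≠ b w ∧ a x ≠ b w ∧ b x ≠ a w := by
      intro x hx
      have hxw : x ≠ w := fun h => hw (h ▸ hx)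
      have hx' := Finset.mem_insert_of_mem (a := x) (b := w) hx
      have hw' := Finset.mem_insert_self w W
      exact ⟨fun h => hxw (haa _ hx' _ hw' h), fun h => hxw (hbb _ hx' _ hw' h),
        hab _ hx' _ hw', (hab _ hw' _ hx').symm⟩
    have habw : a w ≠ b w := hab w (by simp) w (by simp)
    set E' := (E.erase (a w)).erase (b w) with hE'
    have hbE' : b w ∉ E' := by simp [hE']
    have haE' : a w ∉ insert (b w) E' := by simp [hE', habw]
    have hE : E = insert (a w) (insert (b w) E') := by
      rw [hE', Finset.insert_erase, Finset.insert_erase (ha w (by simp))]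
      exact Finset.mem_erase.2 ⟨habw.symm, hb w (by simp)⟩
    have key := ih E'
      (fun x hx => by
        simp only [hE', Finset.mem_erase]
        exact ⟨(hne x hx).2.2.1, (hne x hx).1, ha x (Finset.mem_insert_of_mem hx)⟩)
      (fun x hx => by
        simp only [hE', Finset.mem_erase]
        exact ⟨(hne x hx).2.1, (hne x hx).2.2.2, hb x (Finset.mem_insert_of_mem hx)⟩)
      (fun x hx y hy => hab x (Finset.mem_insert_of_mem hx) y (Finset.mem_insert_of_mem hy))
      (fun x hx y hy => haa x (Finset.mem_insert_of_mem hx) y (Finset.mem_insert_of_mem hy))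
      (fun x hx y hy => hbb x (Finset.mem_insert_of_mem hx) y (Finset.mem_insert_of_mem hy))
    rw [hE, bernoulliSum_insert p haE', bernoulliSum_insert p hbE', bernoulliSum_insert p hbE',
      Finset.card_insert_of_notMem hw, pow_succ, ← key]
    have hiff : ∀ T : Finset α, T ⊆ {a w, b w} → ∀ S ⊆ E',
        ((∀ x ∈ insert w W, ¬(a x ∈ T ∪ S ∧ b x ∈ T ∪ S)) ↔
          ¬(a w ∈ T ∧ b w ∈ T) ∧ ∀ x ∈ W, ¬(a x ∈ S ∧ b x ∈ S)) := by
      intro T hT S hS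
      have h1 : a w ∉ S := fun h => haE' (Finset.mem_insert_of_mem (hS h))
      have h2 : b w ∉ S := fun h => hbE' (hS h)
      have h3 : ∀ x ∈ W, a x ∉ T ∧ b x ∉ T := fun x hx =>
        ⟨fun h => by
          have := hT h
          simp [hne x hx] at this,
        fun h => by
          have := hT h
          simp [hne x hx] at this⟩
      rw [Finset.forall_mem_insert]
      simp only [Finset.mem_union, h1, h2, or_false]
      refine and_congr_right fun _ => forall₂_congr fun x hx => ?_
      simp [h3 x hx]
    have hcongr : ∀ T : Finset α, T ⊆ {a w, b w} → ¬(a w ∈ T ∧ b w ∈ T) →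
        bernoulliSum p E' (fun S => avoidsPairs a b (insert w W) (T ∪ S)) =
        bernoulliSum p E' (avoidsPairs a b W) := by
      intro T hT hn
      refine Finset.sum_congr rfl fun S hS => ?_
      refine congrArg _ (avoidsPairs_congr ?_)
      rw [hiff T hT S (Finset.mem_powerset.1 hS), and_iff_right hn]
    have hzero : bernoulliSum p E'
        (fun S => avoidsPairs a b (insert w W) ({a w, b w} ∪ S)) = 0 := by
      refine Finset.sum_eq_zero fun S hS => ?_
      simp only [avoidsPairs, hiff _ subset_rfl S (Finset.mem_powerset.1 hS)]
      simp
    have e0 := hcongr ∅ (by simp) (by simp)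
    have e1 := hcongr {a w} (by simp) (by simp [habw.symm])
    have e2 := hcongr {b w} (by simp) (by simp [habw])
    simp only [Finset.empty_union] at e0
    simp only [Finset.singleton_union] at e1 e2
    simp only [Finset.insert_union, Finset.singleton_union] at hzero
    rw [e1, e2, hzero, e0]
    ring

/-- The number of edges of the complete multipartite graph with part sizes `sz`. -/
theorem card_edgeFinset_completeMultipartite (k : ℕ) (sz : Fin k → ℕ) :
    (SimpleGraph.completeMultipartiteGraph fun i => Fin (sz i)).edgeFinset.card =
      crossPairs k sz := by
  have himage : (SimpleGraph.completeMultipartiteGraph fun i => Fin (sz i)).edgeFinset =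
      (Finset.univ.filter fun x : (Σ i : Fin k, Fin (sz i)) × (Σ i : Fin k, Fin (sz i)) =>
        x.1.1 < x.2.1).image fun x => s(x.1, x.2) := by
    ext e
    induction e with
    | h u v =>
      simp only [SimpleGraph.mem_edgeFinset, SimpleGraph.mem_edgeSet, Finset.mem_image,
        Finset.mem_filter, Finset.mem_univ, true_and, Prod.exists, Sym2.eq_iff]
      change u.1 ≠ v.1 ↔ _
      constructor
      · intro h
        rcases lt_or_gt_of_ne h with h | h
        · exact ⟨u, v, h, Or.inl ⟨rfl, rfl⟩⟩
        · exact ⟨v, u, h, Or.inr ⟨rfl, rfl⟩⟩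
      · rintro ⟨x, y, h, ⟨rfl, rfl⟩ | ⟨rfl, rfl⟩⟩
        · exact h.ne
        · exact h.ne'
  rw [himage, Finset.card_image_of_injOn]
  · rw [Finset.card_filter, Fintype.sum_prod_type, Fintype.sum_sigma]
    simp only [Fintype.sum_sigma, crossPairs]
    refine Finset.sum_congr rfl fun i _ => ?_
    rw [Finset.sum_comm]
    refine Finset.sum_congr rfl fun j _ => ?_
    split_ifs <;> simp
  · rintro ⟨u, v⟩ h ⟨u', v'⟩ h' heq
    simp only [Finset.coe_filter, Finset.mem_univ, true_and, Set.mem_ofPred_eq] at h h'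
    rcases Sym2.eq_iff.1 heq with ⟨rfl, rfl⟩ | ⟨rfl, rfl⟩
    · rfl
    · exact absurd h h'.asymm

/-- A graph on a nonempty vertex set in which any two distinct vertices have a common
neighbour is connected with diameter at most two. -/
theorem connected_and_dist_le_two {V : Type*} [Nonempty V] (G : SimpleGraph V)
    (h : ∀ u v, u ≠ v → ∃ w, G.Adj u w ∧ G.Adj v w) :
    G.Connected ∧ ∀ u v, G.dist u v ≤ 2 := by
  have hw : ∀ u v, ∃ q : G.Walk u v, q.length ≤ 2 := by
    intro u v
    by_cases huv : u = v
    · subst huv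
      exact ⟨SimpleGraph.Walk.nil, by simp⟩
    · obtain ⟨w, h1, h2⟩ := h u v huv
      exact ⟨SimpleGraph.Walk.cons h1 (SimpleGraph.Walk.cons h2.symm SimpleGraph.Walk.nil),
        by simp⟩
  refine ⟨SimpleGraph.connected_iff _ |>.2 ⟨fun u v => ⟨(hw u v).choose⟩, inferInstance⟩, ?_⟩
  intro u v
  obtain ⟨q, hq⟩ := hw u v
  exact (SimpleGraph.dist_le q).trans hq

theorem kpartiteDiam2Prob_eq_bernoulliSum (k : ℕ) (sz : Fin k → ℕ) (p : ℝ) :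
    kpartiteDiam2Prob k sz p =
      bernoulliSum p (SimpleGraph.completeMultipartiteGraph fun i => Fin (sz i)).edgeFinset
        (fun S => if (SimpleGraph.fromEdgeSet (S : Set (Sym2 (Σ i : Fin k, Fin (sz i))))).Connected ∧
          ∀ u v, (SimpleGraph.fromEdgeSet (S : Set (Sym2 (Σ i : Fin k, Fin (sz i))))).dist u v ≤ 2
          then 1 else 0) := by
  unfold kpartiteDiam2Prob bernoulliSum
  rw [card_edgeFinset_completeMultipartite]
  simp only [mul_ite, mul_one, mul_zero, ite_and]
  rw [← Finset.sum_filter]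
  refine Finset.sum_bij' (fun G _ => G.edgeFinset)
    (fun S _ => SimpleGraph.fromEdgeSet (S : Set (Sym2 (Σ i : Fin k, Fin (sz i))))) ?_ ?_ ?_ ?_ ?_
  · intro G hG
    rw [Finset.mem_powerset, SimpleGraph.edgeFinset_subset_edgeFinset]
    intro u v huv
    exact (Finset.mem_filter.1 hG).2 u v huv
  · intro S hS
    refine Finset.mem_filter.2 ⟨Finset.mem_univ _, fun u v huv => ?_⟩
    have := Finset.mem_powerset.1 hS ((SimpleGraph.fromEdgeSet_adj _).1 huv).1
    rw [SimpleGraph.mem_edgeFinset, SimpleGraph.mem_edgeSet] at this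
    exact this
  · intro G _
    simp
  · intro S hS
    ext e
    simp only [SimpleGraph.mem_edgeFinset, SimpleGraph.edgeSet_fromEdgeSet]
    refine ⟨fun h => h.1, fun h => ⟨h, fun hd => ?_⟩⟩
    have h2 := Finset.mem_powerset.1 hS h
    exact SimpleGraph.not_isDiag_of_mem_edgeFinset h2 hd
  · intro G _
    simp only [SimpleGraph.coe_edgeFinset, SimpleGraph.fromEdgeSet_edgeSet]
    rw [Nat.card_eq_fintype_card, SimpleGraph.edgeFinset_card]

/-- The set of vertices lying in neither the part of `u` nor the part of `v`. -/
noncomputable def outsideParts {k : ℕ} {sz : Fin k → ℕ} (u v : Σ i : Fin k, Fin (sz i)) :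
    Finset (Σ i : Fin k, Fin (sz i)) :=
  Finset.univ.filter fun w => w.1 ≠ u.1 ∧ w.1 ≠ v.1

/-- The first-moment lower bound for the probability of diameter at most two. -/
theorem one_sub_le_kpartiteDiam2Prob (k : ℕ) (sz : Fin k → ℕ)
    [Nonempty (Σ i : Fin k, Fin (sz i))] {p : ℝ} (hp : p ∈ Set.Ioo (0 : ℝ) 1) :
    1 - (∑ u : Σ i : Fin k, Fin (sz i), ∑ v : Σ i : Fin k, Fin (sz i),
        (1 - p ^ 2) ^ (outsideParts u v).card) / 2 ≤ kpartiteDiam2Prob k sz p := by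
  rw [kpartiteDiam2Prob_eq_bernoulliSum]
  set E := (SimpleGraph.completeMultipartiteGraph fun i => Fin (sz i)).edgeFinset with hE
  have hmem : ∀ u v : Σ i : Fin k, Fin (sz i), u.1 ≠ v.1 → s(u, v) ∈ E := by
    intro u v h
    rw [hE, SimpleGraph.mem_edgeFinset, SimpleGraph.mem_edgeSet]
    exact h
  let bad (u v : Σ i : Fin k, Fin (sz i)) (S : Finset (Sym2 (Σ i : Fin k, Fin (sz i)))) : ℝ :=
    avoidsPairs (fun w => s(u, w)) (fun w => s(v, w)) (outsideParts u v) S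
  have hbad0 : ∀ u v S, 0 ≤ bad u v S := fun u v S => by
    simp only [bad, avoidsPairs]
    split_ifs <;> norm_num
  have hprob : ∀ u v : Σ i : Fin k, Fin (sz i), u ≠ v →
      bernoulliSum p E (bad u v) = (1 - p ^ 2) ^ (outsideParts u v).card := by
    intro u v huv
    have hout : ∀ w ∈ outsideParts u v, w.1 ≠ u.1 ∧ w.1 ≠ v.1 := fun w hw =>
      (Finset.mem_filter.1 hw).2
    refine bernoulliSum_avoidsPairs p (fun w => s(u, w)) (fun w => s(v, w)) _ E
      (fun w hw => hmem _ _ (hout w hw).1.symm) (fun w hw => hmem _ _ (hout w hw).2.symm) ?_ ?_ ?_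
    · intro w hw w' hw' h
      rcases Sym2.eq_iff.1 h with ⟨h, _⟩ | ⟨h, _⟩
      · exact huv h
      · exact (hout w' hw').1 (congrArg Sigma.fst h.symm)
    · intro w _ w' _ h
      exact Sym2.congr_right.1 h
    · intro w _ w' _ h
      exact Sym2.congr_right.1 h
  have hsum : bernoulliSum p E (fun S => 1 - (∑ u, ∑ v, if u = v then 0 else bad u v S) / 2) =
      1 - (∑ u, ∑ v, if u = v then 0 else bernoulliSum p E (bad u v)) / 2 := by
    have h1 := bernoulliSum_one p E
    unfold bernoulliSum at h1 ⊢
    simp only [mul_sub, Finset.sum_sub_distrib, h1]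
    congr 1
    simp only [← mul_div_assoc, ← Finset.sum_div, Finset.mul_sum]
    congr 1
    rw [Finset.sum_comm]
    refine Finset.sum_congr rfl fun u _ => ?_
    rw [Finset.sum_comm]
    refine Finset.sum_congr rfl fun v _ => ?_
    split_ifs <;> simp
  have hp2 : 0 ≤ 1 - p ^ 2 := by nlinarith [hp.1, hp.2]
  calc _ ≤ 1 - (∑ u, ∑ v, if u = v then 0 else bernoulliSum p E (bad u v)) / 2 := by
        gcongr with u _ v _
        split_ifs with h
        · positivity
        · exact (hprob u v h).le
    _ = _ := hsum.symm
    _ ≤ _ := by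
        refine bernoulliSum_mono hp E fun S hS => ?_
        have hterm : ∀ u v, 0 ≤ if u = v then 0 else bad u v S := fun u v => by
          split_ifs
          exacts [le_rfl, hbad0 u v S]
        split_ifs with hgood
        · have : 0 ≤ ∑ u, ∑ v, if u = v then 0 else bad u v S :=
            Finset.sum_nonneg fun u _ => Finset.sum_nonneg fun v _ => hterm u v
          linarith
        · have hex : ∃ u v, u ≠ v ∧ bad u v S = 1 := by
            by_contra! hcon
            refine hgood (connected_and_dist_le_two _ fun u v huv => ?_)
            have hpair : ¬∀ w ∈ outsideParts u v, ¬(s(u, w) ∈ S ∧ s(v, w) ∈ S) :=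
              fun h => hcon u v huv (if_pos h)
            push Not at hpair
            obtain ⟨w, hw, h1, h2⟩ := hpair
            have hw := (Finset.mem_filter.1 hw).2
            exact ⟨w, (SimpleGraph.fromEdgeSet_adj _).2 ⟨h1, fun h => hw.1 (h ▸ rfl)⟩,
              (SimpleGraph.fromEdgeSet_adj _).2 ⟨h2, fun h => hw.2 (h ▸ rfl)⟩⟩
          obtain ⟨u, v, huv, hb⟩ := hex
          have hb' : bad v u S = 1 := by
            rw [← hb]
            refine avoidsPairs_congr (forall_congr' fun w => ?_)
            simp only [outsideParts, Finset.mem_filter, Finset.mem_univ, true_and]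
            rw [and_comm (a := w.1 ≠ v.1), and_comm (a := s(v, w) ∈ S)]
          have hrow : ∀ x y, x ≠ y → bad x y S = 1 →
              1 ≤ ∑ v, if x = v then 0 else bad x v S := by
            intro x y hxy h
            have := Finset.single_le_sum (f := fun v => if x = v then 0 else bad x v S)
              (fun v _ => hterm x v) (Finset.mem_univ y)
            simpa [hxy, h] using this
          have h2 : ∑ x ∈ {u, v}, (∑ y, if x = y then 0 else bad x y S) ≤
              ∑ x, ∑ y, if x = y then 0 else bad x y S :=
            Finset.sum_le_sum_of_subset_of_nonneg (Finset.subset_univ _)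
              fun x _ _ => Finset.sum_nonneg fun y _ => hterm x y
          rw [Finset.sum_pair huv] at h2
          linarith [hrow u v huv hb, hrow v u huv.symm hb']

theorem turanSizes_bounds (k n : ℕ) (hk : 0 < k) (i : Fin k) :
    (n : ℝ) / k - 1 ≤ turanSizes k n i ∧ (turanSizes k n i : ℝ) ≤ n / k + 1 := by
  have hk' : (0 : ℝ) < k := by exact_mod_cast hk
  have h1 : (n : ℝ) / k < (n / k : ℕ) + 1 := by
    rw [div_lt_iff₀ hk']
    have := Nat.lt_mul_div_succ n hk
    have h : n < (n / k + 1) * k := by linarith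
    exact_mod_cast h
  have h2 : ((n / k : ℕ) : ℝ) ≤ n / k := Nat.cast_div_le
  unfold turanSizes
  split_ifs <;> push_cast <;> constructor <;> linarith

theorem card_outsideParts {k : ℕ} {sz : Fin k → ℕ} (u v : Σ i : Fin k, Fin (sz i)) :
    (outsideParts u v).card = ∑ i ∈ ({u.1, v.1} : Finset (Fin k))ᶜ, sz i := by
  unfold outsideParts
  rw [Finset.card_filter, Fintype.sum_sigma, ← Finset.sum_filter_add_sum_filter_not Finset.univ
    (fun i => i ∈ ({u.1, v.1} : Finset (Fin k))ᶜ)]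
  rw [Finset.filter_mem_eq_inter, Finset.univ_inter]
  have h0 : ∑ x with x ∉ ({u.1, v.1} : Finset (Fin k))ᶜ,
      ∑ y : Fin (sz x), (if x ≠ u.1 ∧ x ≠ v.1 then 1 else 0) = 0 := by
    refine Finset.sum_eq_zero fun x hx => Finset.sum_eq_zero fun y _ => if_neg ?_
    simpa using (Finset.mem_filter.1 hx).2
  rw [h0, add_zero]
  refine Finset.sum_congr rfl fun i hi => ?_
  have : i ≠ u.1 ∧ i ≠ v.1 := by simpa using hi
  simp [this]

theorem one_sub_pow_le_exp {x m : ℝ} {d : ℕ} (hx0 : 0 ≤ x) (hx1 : x ≤ 1) (hm : m ≤ d) :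
    (1 - x) ^ d ≤ Real.exp (-x * m) := by
  calc (1 - x) ^ d ≤ Real.exp (-x) ^ d :=
        pow_le_pow_left₀ (by linarith) (Real.one_sub_le_exp_neg x) d
    _ = Real.exp (-x * d) := by rw [← Real.exp_nat_mul]; ring_nf
    _ ≤ _ := Real.exp_le_exp.2 (by nlinarith)

theorem turan_outside_pow_le {k n : ℕ} (hk : 2 ≤ k) {p : ℝ} (hp : p ∈ Set.Ioo (0 : ℝ) 1)
    (u v : Σ i : Fin k, Fin (turanSizes k n i)) :
    (1 - p ^ 2) ^ (outsideParts u v).card ≤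
      Real.exp (k * p ^ 2) * Real.exp (-(n * p ^ 2 * (1 - 1 / k))) *
        if u.1 = v.1 then 1 else Real.exp (n * p ^ 2 / k) := by
  have hk' : (2 : ℝ) ≤ k := by exact_mod_cast hk
  have hk0 : (k : ℝ) ≠ 0 := by positivity
  have hp2 : p ^ 2 ≤ 1 := by nlinarith [hp.1, hp.2]
  have hp0 : 0 ≤ p ^ 2 := by positivity
  set c := ({u.1, v.1} : Finset (Fin k))ᶜ.card with hc
  have hcard : (c : ℝ) * (n / k - 1) ≤ (outsideParts u v).card := by
    rw [card_outsideParts, Nat.cast_sum, ← nsmul_eq_mul]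
    exact Finset.card_nsmul_le_sum _ _ _ fun i _ => (turanSizes_bounds k n (by omega) i).1
  refine (one_sub_pow_le_exp hp0 hp2 hcard).trans ?_
  by_cases h : u.1 = v.1
  · have hc' : (c : ℝ) = k - 1 := by
      rw [hc, h, Finset.card_compl]
      simp only [Finset.mem_singleton, Finset.insert_eq_of_mem, Finset.card_singleton,
        Fintype.card_fin]
      push_cast [Nat.cast_sub (show 1 ≤ k by omega)]
      ring
    rw [if_pos h, mul_one, ← Real.exp_add, Real.exp_le_exp, hc']
    have : -p ^ 2 * ((k - 1) * (n / k - 1)) =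
        k * p ^ 2 + -(n * p ^ 2 * (1 - 1 / k)) - p ^ 2 := by
      field_simp
      ring
    linarith
  · have hc' : (c : ℝ) = k - 2 := by
      rw [hc, Finset.card_compl, Finset.card_pair h, Fintype.card_fin, Nat.cast_sub hk]
      norm_num
    rw [if_neg h, ← Real.exp_add, ← Real.exp_add, Real.exp_le_exp, hc']
    have : -p ^ 2 * ((k - 2) * (n / k - 1)) =
        k * p ^ 2 + -(n * p ^ 2 * (1 - 1 / k)) + n * p ^ 2 / k - 2 * p ^ 2 := by
      field_simp
      ring
    linarith

theorem sum_sum_fst {k : ℕ} (sz : Fin k → ℕ) (g : Fin k → Fin k → ℝ) :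
    ∑ u : Σ i : Fin k, Fin (sz i), ∑ v : Σ i : Fin k, Fin (sz i), g u.1 v.1 =
      ∑ i, ∑ j, (sz i : ℝ) * sz j * g i j := by
  simp only [Fintype.sum_sigma, Finset.sum_const, Finset.card_univ, Fintype.card_fin,
    nsmul_eq_mul, Finset.mul_sum, mul_assoc]

theorem turan_sum_outside_pow_le {k n : ℕ} (hk : 2 ≤ k) {p : ℝ} (hp : p ∈ Set.Ioo (0 : ℝ) 1) :
    ∑ u : Σ i : Fin k, Fin (turanSizes k n i), ∑ v : Σ i : Fin k, Fin (turanSizes k n i),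
        (1 - p ^ 2) ^ (outsideParts u v).card ≤
      k * (n / k + 1) ^ 2 * (Real.exp (k * p ^ 2) * Real.exp (-(n * p ^ 2 * (1 - 1 / k)))) *
        (1 + (k - 1) * Real.exp (n * p ^ 2 / k)) := by
  set A := Real.exp (k * p ^ 2) * Real.exp (-(n * p ^ 2 * (1 - 1 / k))) with hA
  set B := Real.exp (n * p ^ 2 / k) with hB
  have hA0 : 0 ≤ A := by positivity
  have hB0 : 0 ≤ B := by positivity
  calc _ ≤ ∑ u : Σ i : Fin k, Fin (turanSizes k n i), ∑ v : Σ i : Fin k, Fin (turanSizes k n i),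
        A * (if u.1 = v.1 then 1 else B) :=
        Finset.sum_le_sum fun u _ => Finset.sum_le_sum fun v _ => turan_outside_pow_le hk hp u v
    _ = ∑ i : Fin k, ∑ j : Fin k, (turanSizes k n i : ℝ) * (turanSizes k n j) *
          (A * if i = j then 1 else B) :=
        sum_sum_fst _ fun i j => A * if i = j then 1 else B
    _ ≤ ∑ i : Fin k, ∑ j : Fin k, (n / k + 1) ^ 2 * (A * if i = j then 1 else B) := by
        refine Finset.sum_le_sum fun i _ => Finset.sum_le_sum fun j _ => ?_
        have hi := (turanSizes_bounds k n (by omega) i).2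
        have hj := (turanSizes_bounds k n (by omega) j).2
        have h0 : 0 ≤ A * if i = j then 1 else B := by
          split_ifs <;> positivity
        rw [sq]
        gcongr
    _ = _ := by
        simp only [← Finset.mul_sum]
        have hrow : ∀ i : Fin k, ∑ j : Fin k, (if i = j then 1 else B) = 1 + (k - 1) * B := by
          intro i
          have : ∀ j : Fin k, (if i = j then 1 else B) = B + if i = j then 1 - B else 0 := by
            intro j
            split_ifs <;> ring
          simp only [this, Finset.sum_add_distrib, Finset.sum_ite_eq, Finset.sum_const,
            Finset.card_univ, Fintype.card_fin, nsmul_eq_mul, Finset.mem_univ, if_true]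
          ring
        simp only [hrow, Finset.sum_const, Finset.card_univ, Fintype.card_fin, nsmul_eq_mul]
        ring

theorem nonempty_turan_vertices {k n : ℕ} (hk : 0 < k) (hn : k ≤ n) :
    Nonempty (Σ i : Fin k, Fin (turanSizes k n i)) := by
  have h := Nat.div_pos hn hk
  refine ⟨⟨⟨0, hk⟩, ⟨0, ?_⟩⟩⟩
  unfold turanSizes
  split_ifs <;> omega

theorem one_sub_le_turanKpartiteDiam2Prob {k n : ℕ} (hk : 2 ≤ k) (hn : k ≤ n) {p : ℝ}
    (hp : p ∈ Set.Ioo (0 : ℝ) 1) :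
    1 - (1 + k / (n : ℝ)) ^ 2 * Real.exp (k * p ^ 2) *
      Real.exp (2 * Real.log n - Real.log k - (n : ℝ) * p ^ 2 * (1 - 1 / (k : ℝ)) -
          Real.log 2 + Real.log (1 + ((k : ℝ) - 1) * Real.exp ((n : ℝ) * p ^ 2 / (k : ℝ)))) ≤
      turanKpartiteDiam2Prob k n p := by
  have : Nonempty (Σ i : Fin k, Fin (turanSizes k n i)) := nonempty_turan_vertices (by omega) hn
  have hk' : (2 : ℝ) ≤ k := by exact_mod_cast hk
  have hk0 : (0 : ℝ) < k := by positivity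
  have hn0 : (0 : ℝ) < n := by
    have : 0 < n := by omega
    exact_mod_cast this
  have hB : 0 < 1 + ((k : ℝ) - 1) * Real.exp ((n : ℝ) * p ^ 2 / (k : ℝ)) := by
    have : 0 ≤ (k : ℝ) - 1 := by linarith
    positivity
  refine le_trans ?_ (one_sub_le_kpartiteDiam2Prob k (turanSizes k n) hp)
  have hsum := turan_sum_outside_pow_le (n := n) hk hp
  refine sub_le_sub_left (le_trans (div_le_div_of_nonneg_right hsum two_pos.le) (le_of_eq ?_)) 1
  rw [Real.exp_add, Real.exp_sub, Real.exp_sub, Real.exp_sub, Real.exp_log hB,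
    Real.exp_log two_pos, Real.exp_log hk0, two_mul, Real.exp_add, Real.exp_log hn0, Real.exp_neg]
  field_simp

/-- If `n p(n)⁴ → 0` and the critical sequence tends to `c < 0`, then for every
`ε > 0`, for all large `n`, `P_k^t(n, p(n)) ≥ 1 - (1+ε) e^c`. -/
theorem turanKpartiteDiam2Prob_lower_critical (k : ℕ) (hk : 3 ≤ k)
    (p : ℕ → ℝ) (hp : ∀ n, p n ∈ Set.Ioo (0 : ℝ) 1)
    (hp4 : Filter.Tendsto (fun n : ℕ => (n : ℝ) * (p n) ^ 4) Filter.atTop (nhds 0))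
    (c : ℝ) (hc : c < 0)
    (hconv : Filter.Tendsto
      (fun n : ℕ =>
        2 * Real.log n - Real.log k - (n : ℝ) * (p n) ^ 2 * (1 - 1 / (k : ℝ)) -
          Real.log 2 +
          Real.log (1 + ((k : ℝ) - 1) * Real.exp ((n : ℝ) * (p n) ^ 2 / (k : ℝ))))
      Filter.atTop (nhds c)) :
    ∀ ε > (0 : ℝ), ∃ N : ℕ, ∀ n ≥ N,
      1 - (1 + ε) * Real.exp c ≤ turanKpartiteDiam2Prob k n (p n) := by
  intro ε hε
  have hp2 : Filter.Tendsto (fun n => (p n) ^ 2) Filter.atTop (nhds 0) := by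
    have hp4' : Filter.Tendsto (fun n => (p n) ^ 4) Filter.atTop (nhds 0) := by
      refine squeeze_zero' (Filter.Eventually.of_forall fun n => by positivity) ?_ hp4
      filter_upwards [Filter.eventually_ge_atTop 1] with n hn
      have h1 : (1 : ℝ) ≤ n := by exact_mod_cast hn
      have h2 : 0 ≤ (p n) ^ 4 := by positivity
      nlinarith
    have hsqrt := hp4'.sqrt
    rw [Real.sqrt_zero] at hsqrt
    refine hsqrt.congr fun n => ?_
    rw [show (p n) ^ 4 = ((p n) ^ 2) ^ 2 by ring, Real.sqrt_sq (by positivity)]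
  have hn : Filter.Tendsto (fun n : ℕ => (k : ℝ) / (n : ℝ)) Filter.atTop (nhds 0) :=
    tendsto_const_div_atTop_nhds_zero_nat _
  have hlim := (((hn.const_add 1).pow 2).mul
    ((Real.continuous_exp.tendsto _).comp (hp2.const_mul (k : ℝ)))).mul
    ((Real.continuous_exp.tendsto _).comp hconv)
  simp only [add_zero, one_pow, mul_zero, Real.exp_zero, one_mul] at hlim
  have hlt : Real.exp c < (1 + ε) * Real.exp c := by
    nlinarith [Real.exp_pos c]
  obtain ⟨N, hN⟩ := Filter.eventually_atTop.1
    ((hlim.eventually_lt_const hlt).and (Filter.eventually_ge_atTop k))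
  refine ⟨N, fun n hnN => ?_⟩
  obtain ⟨h1, h2⟩ := hN n hnN
  refine le_trans ?_ (one_sub_le_turanKpartiteDiam2Prob (by omega) h2 (hp n))
  simp only [Function.comp_apply] at h1
  linarith
end

section
/- Fix k ≥ 3 and let p : ℕ → (0,1) be a sequence with n·p(n)⁴ → 0 as n → ∞. Suppose that the sequence 2·log n − log k − n·p(n)²·(1 − 1/k) − log 2 + log(1 + (k−1)·e^{n·p(n)²/k}) converges to some real number c with c > 0. Then for every ε > 0 there exists N such that for all n ≥ N, the probability P_k^t(n,p(n)) that a random Turán k-partite graph on n vertices with edge probability p(n) has diameter at most 2 satisfies P_k^t(n,p(n)) ≤ (1+ε)·e^{−c}. -/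
open scoped Classical

section SecondMoment

open Finset

/-- The expectation of `F S` for a random subset `S` of `E` that contains each element
independently with probability `p`. -/
noncomputable def subsetExp {α : Type*} (p : ℝ) (E : Finset α) (F : Finset α → ℝ) : ℝ :=
  ∑ S ∈ E.powerset, p ^ #S * (1 - p) ^ (#E - #S) * F S

/-- The indicator function of a property of sets. -/
noncomputable def ind {α : Type*} (A : Finset α → Prop) (S : Finset α) : ℝ :=
  if A S then 1 else 0

section subsetExp

variable {α β : Type*} {p : ℝ} {E : Finset α}

lemma subsetExp_congr {F G : Finset α → ℝ} (h : ∀ S ⊆ E, F S = G S) :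
    subsetExp p E F = subsetExp p E G :=
  Finset.sum_congr rfl fun S hS => by rw [h S (mem_powerset.1 hS)]

lemma subsetExp_mono (hp0 : 0 ≤ p) (hp1 : p ≤ 1) {F G : Finset α → ℝ}
    (h : ∀ S ⊆ E, F S ≤ G S) : subsetExp p E F ≤ subsetExp p E G :=
  Finset.sum_le_sum fun S hS => by
    have := h S (mem_powerset.1 hS)
    have : 0 ≤ 1 - p := by linarith
    gcongr

lemma subsetExp_one : subsetExp p E (fun _ => 1) = 1 := by
  simp [subsetExp, Finset.sum_pow_mul_eq_add_pow]

lemma subsetExp_add (F G : Finset α → ℝ) :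
    subsetExp p E (fun S => F S + G S) = subsetExp p E F + subsetExp p E G := by
  simp [subsetExp, mul_add, Finset.sum_add_distrib]

lemma subsetExp_sub (F G : Finset α → ℝ) :
    subsetExp p E (fun S => F S - G S) = subsetExp p E F - subsetExp p E G := by
  simp [subsetExp, mul_sub, Finset.sum_sub_distrib]

lemma subsetExp_const_mul (c : ℝ) (F : Finset α → ℝ) :
    subsetExp p E (fun S => c * F S) = c * subsetExp p E F := by
  simp only [subsetExp, Finset.mul_sum]
  exact Finset.sum_congr rfl fun S _ => by ring

lemma subsetExp_sum (Q : Finset β) (F : β → Finset α → ℝ) :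
    subsetExp p E (fun S => ∑ q ∈ Q, F q S) = ∑ q ∈ Q, subsetExp p E (F q) := by
  simp only [subsetExp, Finset.mul_sum]
  exact Finset.sum_comm

lemma subsetExp_insert {a : α} (ha : a ∉ E) (F : Finset α → ℝ) :
    subsetExp p (insert a E) F =
      (1 - p) * subsetExp p E F + p * subsetExp p E (fun S => F (insert a S)) := by
  simp only [subsetExp]
  rw [Finset.sum_powerset_insert ha, Finset.mul_sum, Finset.mul_sum]
  congr 1 <;> refine Finset.sum_congr rfl fun S hS => ?_
  · have := Finset.card_le_card (mem_powerset.1 hS)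
    rw [Finset.card_insert_of_notMem ha, Nat.sub_add_comm this, pow_succ]
    ring
  · have haS : a ∉ S := fun h => ha (mem_powerset.1 hS h)
    rw [Finset.card_insert_of_notMem ha, Finset.card_insert_of_notMem haS, pow_succ,
      Nat.add_sub_add_right]
    ring

/-- Functions of disjoint sets of elements are independent. -/
lemma subsetExp_mul (D : Finset α) (F G : Finset α → ℝ)
    (hF : ∀ a ∉ D, ∀ S, F (insert a S) = F S) (hG : ∀ a ∈ D, ∀ S, G (insert a S) = G S) :
    subsetExp p E (fun S => F S * G S) = subsetExp p E F * subsetExp p E G := by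
  induction E using Finset.induction_on generalizing F G with
  | empty => simp [subsetExp]
  | insert a E ha ih =>
    simp only [subsetExp_insert ha]
    by_cases haD : a ∈ D
    · simp only [hG a haD]
      rw [ih F G hF hG, ih (fun S => F (insert a S)) G
        (fun b hb S => by rw [Finset.insert_comm, hF b hb]) hG]
      ring
    · simp only [hF a haD]
      rw [ih F G hF hG, ih F (fun S => G (insert a S)) hF
        (fun b hb S => by rw [Finset.insert_comm, hG b hb])]
      ring

lemma subsetExp_prod (I : Finset β) (D : β → Finset α) (F : β → Finset α → ℝ)
    (hD : (I : Set β).PairwiseDisjoint D)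
    (hF : ∀ i ∈ I, ∀ a ∉ D i, ∀ S, F i (insert a S) = F i S) :
    subsetExp p E (fun S => ∏ i ∈ I, F i S) = ∏ i ∈ I, subsetExp p E (F i) := by
  induction I using Finset.induction_on with
  | empty => simpa using subsetExp_one
  | insert i I hi ih =>
    simp only [Finset.prod_insert hi]
    rw [subsetExp_mul (D i), ih]
    · exact hD.subset (by simp)
    · exact fun j hj => hF j (mem_insert_of_mem hj)
    · exact hF i (mem_insert_self _ _)
    · intro a ha S
      refine Finset.prod_congr rfl fun j hj => hF j (mem_insert_of_mem hj) a ?_ S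
      have hne : i ≠ j := fun h => hi (h ▸ hj)
      exact Finset.disjoint_left.1 (hD (by simp) (by simp [hj]) hne) ha

lemma subsetExp_mem {a : α} (ha : a ∈ E) : subsetExp p E (ind fun S => a ∈ S) = p := by
  rw [← Finset.insert_erase ha, subsetExp_insert (Finset.notMem_erase a E)]
  rw [subsetExp_congr (G := fun _ => 0 * 1), subsetExp_const_mul]
  · simp [ind, subsetExp_one]
  · intro S hS
    have : a ∉ S := fun h => Finset.notMem_erase a E (hS h)
    simp [ind, this]

lemma subsetExp_subset {T : Finset α} (hT : T ⊆ E) :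
    subsetExp p E (ind fun S => T ⊆ S) = p ^ #T := by
  have h : (ind fun S => T ⊆ S) = fun S => ∏ t ∈ T, ind (fun S => t ∈ S) S := by
    ext S
    by_cases hS : T ⊆ S
    · rw [Finset.prod_eq_one fun t ht => by simp [ind, hS ht]]
      simp [ind, hS]
    · obtain ⟨t, ht, htS⟩ := Finset.not_subset.1 hS
      rw [Finset.prod_eq_zero ht (by simp [ind, htS])]
      simp [ind, hS]
  rw [h, subsetExp_prod T (fun t => {t})]
  · rw [Finset.prod_congr rfl fun t ht => subsetExp_mem (hT ht), Finset.prod_const]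
  · intro i _ j _ hij
    simpa using hij
  · intro t _ a ha S
    have : t ≠ a := by simpa [eq_comm] using ha
    simp [ind, this]

lemma subsetExp_not_subset {T : Finset α} (hT : T ⊆ E) :
    subsetExp p E (ind fun S => ¬ T ⊆ S) = 1 - p ^ #T := by
  rw [← subsetExp_subset hT, ← subsetExp_one (p := p) (E := E), ← subsetExp_sub]
  refine subsetExp_congr fun S _ => ?_
  by_cases h : T ⊆ S <;> simp [ind, h]

lemma subsetExp_not_subset_and [DecidableEq α] {T U : Finset α} (hT : T ⊆ E) (hU : U ⊆ E) :
    subsetExp p E (ind fun S => ¬ T ⊆ S ∧ ¬ U ⊆ S) = 1 - p ^ #T - p ^ #U + p ^ #(T ∪ U) := by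
  rw [← subsetExp_subset hT, ← subsetExp_subset hU, ← subsetExp_subset (union_subset hT hU),
    ← subsetExp_one (p := p) (E := E), ← subsetExp_sub, ← subsetExp_sub, ← subsetExp_add]
  refine subsetExp_congr fun S _ => ?_
  by_cases h : T ⊆ S <;> by_cases h' : U ⊆ S <;> simp [ind, h, h', Finset.union_subset_iff]

/-- The second moment method: an upper bound for the probability that none of the events
`A q` occurs. -/
lemma subsetExp_none_le (hp0 : 0 ≤ p) (hp1 : p ≤ 1) (Q : Finset β) (A : β → Finset α → Prop)
    {δ : ℝ} (hδ : 0 ≤ δ) (hm : 0 < ∑ q ∈ Q, subsetExp p E (ind (A q)))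
    (hA : ∀ q ∈ Q, ∀ r ∈ Q, q ≠ r → subsetExp p E (ind fun S => A q S ∧ A r S) ≤
      (1 + δ) * (subsetExp p E (ind (A q)) * subsetExp p E (ind (A r)))) :
    subsetExp p E (ind fun S => ∀ q ∈ Q, ¬ A q S) ≤
      (∑ q ∈ Q, subsetExp p E (ind (A q)))⁻¹ + δ := by
  set μ : β → ℝ := fun q => subsetExp p E (ind (A q)) with hμ
  set m := ∑ q ∈ Q, μ q with hmdef
  have hμ0 : ∀ q, 0 ≤ μ q := fun q => by
    have := subsetExp_mono (E := E) hp0 hp1 (F := fun _ => 0 * 1) (G := ind (A q))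
      fun S _ => by unfold ind; split_ifs <;> simp
    rwa [subsetExp_const_mul, zero_mul] at this
  have h1 : m ^ 2 * subsetExp p E (ind fun S => ∀ q ∈ Q, ¬ A q S) ≤
      subsetExp p E (fun S => (∑ q ∈ Q, ∑ r ∈ Q, ind (fun S => A q S ∧ A r S) S) -
        2 * m * (∑ q ∈ Q, ind (A q) S) + m ^ 2 * 1) := by
    rw [← subsetExp_const_mul]
    refine subsetExp_mono hp0 hp1 fun S _ => ?_
    have h2 : ∑ q ∈ Q, ∑ r ∈ Q, ind (fun S => A q S ∧ A r S) S =
        (∑ q ∈ Q, ind (A q) S) ^ 2 := by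
      rw [sq, Finset.sum_mul_sum]
      refine Finset.sum_congr rfl fun q _ => Finset.sum_congr rfl fun r _ => ?_
      by_cases h : A q S <;> by_cases h' : A r S <;> simp [ind, h, h']
    rw [h2]
    by_cases h : ∀ q ∈ Q, ¬ A q S
    · have : ∑ q ∈ Q, ind (A q) S = 0 :=
        Finset.sum_eq_zero fun q hq => by simp [ind, h q hq]
      have h3 : ind (fun S => ∀ q ∈ Q, ¬ A q S) S = 1 := if_pos h
      rw [this, h3]
      simp
    · have h3 : ind (fun S => ∀ q ∈ Q, ¬ A q S) S = 0 := if_neg h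
      rw [h3]
      nlinarith [sq_nonneg (∑ q ∈ Q, ind (A q) S - m)]
  have h2 : subsetExp p E (fun S => (∑ q ∈ Q, ∑ r ∈ Q, ind (fun S => A q S ∧ A r S) S) -
        2 * m * (∑ q ∈ Q, ind (A q) S) + m ^ 2 * 1) =
      ∑ q ∈ Q, ∑ r ∈ Q, subsetExp p E (ind (fun S => A q S ∧ A r S)) - m ^ 2 := by
    rw [subsetExp_add, subsetExp_sub, subsetExp_const_mul, subsetExp_const_mul, subsetExp_one,
      subsetExp_sum, subsetExp_sum]
    simp only [subsetExp_sum]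
    change _ - 2 * m * m + _ = _
    ring
  have h3 : ∑ q ∈ Q, ∑ r ∈ Q, subsetExp p E (ind (fun S => A q S ∧ A r S)) ≤
      m + (1 + δ) * m ^ 2 := by
    have : m + (1 + δ) * m ^ 2 =
        ∑ q ∈ Q, ∑ r ∈ Q, ((if q = r then μ q else 0) + (1 + δ) * (μ q * μ r)) := by
      simp only [Finset.sum_add_distrib, Finset.sum_ite_eq, ← Finset.mul_sum]
      rw [← Finset.sum_mul, sq]
      congr 1
      exact Finset.sum_congr rfl fun q hq => by simp [hq]
    rw [this]
    refine Finset.sum_le_sum fun q hq => Finset.sum_le_sum fun r hr => ?_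
    by_cases h : q = r
    · subst h
      have : 0 ≤ (1 + δ) * (μ q * μ q) := by have := hμ0 q; positivity
      simpa [hμ] using this
    · simpa [h] using hA q hq r hr h
  have h4 : subsetExp p E (ind fun S => ∀ q ∈ Q, ¬ A q S) ≤ (m + δ * m ^ 2) / m ^ 2 := by
    rw [le_div_iff₀ (by positivity)]
    linarith
  refine h4.trans (le_of_eq ?_)
  field_simp

end subsetExp

section ind

variable {α β : Type*}

lemma subset_insert_iff_of_notMem' {T S : Finset α} {a : α} (ha : a ∉ T) :
    T ⊆ insert a S ↔ T ⊆ S :=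
  Finset.subset_insert_iff_of_notMem ha

lemma ind_congr {A B : Finset α → Prop} {S T : Finset α} (h : A S ↔ B T) :
    ind A S = ind B T := by
  simp only [ind, h]

lemma ind_and (A B : Finset α → Prop) (S : Finset α) :
    ind (fun S => A S ∧ B S) S = ind A S * ind B S := by
  by_cases hA : A S <;> by_cases hB : B S <;> simp [ind, hA, hB]

lemma ind_forall (I : Finset β) (A : β → Finset α → Prop) (S : Finset α) :
    ind (fun S => ∀ i ∈ I, A i S) S = ∏ i ∈ I, ind (A i) S := by
  by_cases hS : ∀ i ∈ I, A i S
  · rw [Finset.prod_eq_one fun i hi => by simp [ind, hS i hi]]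
    exact if_pos hS
  · have h0 : ind (fun S => ∀ i ∈ I, A i S) S = 0 := if_neg hS
    push Not at hS
    obtain ⟨i, hi, hiS⟩ := hS
    rw [Finset.prod_eq_zero hi (by simp [ind, hiS]), h0]

lemma ind_mono {A B : Finset α → Prop} {S : Finset α} (h : A S → B S) : ind A S ≤ ind B S := by
  by_cases hA : A S
  · simp [ind, hA, h hA]
  · by_cases hB : B S <;> simp [ind, hA, hB]

end ind

lemma exp_le_one_sub {x : ℝ} (h0 : 0 ≤ x) (h1 : x ≤ 1 / 2) :
    Real.exp (-(x + x ^ 2)) ≤ 1 - x := by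
  rw [Real.exp_neg, inv_le_comm₀ (Real.exp_pos _) (by linarith)]
  refine le_trans ?_ (Real.quadratic_le_exp_of_nonneg (x := x + x ^ 2) (by positivity))
  rw [inv_le_iff_one_le_mul₀ (by linarith)]
  have : 0 ≤ x ^ 2 * (1 - x - x ^ 2 - x ^ 3) := by
    have h2 : x ^ 2 ≤ (1 / 2) ^ 2 := by gcongr
    have h3 : x ^ 3 ≤ (1 / 2) ^ 3 := by gcongr
    refine mul_nonneg (by positivity) (by linarith)
  nlinarith

section bad

variable {V : Type*} {k : ℕ}

/-- The two potential edges from `w` to `u` and `v`. -/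
noncomputable def spokes (u v w : V) : Finset (Sym2 V) := {s(w, u), s(w, v)}

/-- In the multipartite graph with edge set `S`, the vertices `u` and `v` are neither adjacent
nor do they have a common neighbour. -/
def IsBad (part : V → Fin k) (u v : V) (S : Finset (Sym2 V)) : Prop :=
  s(u, v) ∉ S ∧ ∀ w, part w ≠ part u ∧ part w ≠ part v → ¬ spokes u v w ⊆ S

/-- The possible common neighbours of `u` and `v`. -/
noncomputable def outside [Fintype V] (part : V → Fin k) (u v : V) : Finset V :=
  univ.filter fun w => part w ≠ part u ∧ part w ≠ part v

lemma card_spokes {u v : V} (h : u ≠ v) (w : V) : #(spokes u v w) = 2 :=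
  Finset.card_pair fun h' => h (Sym2.congr_right.1 h')

lemma spokes_eq_image (u v w : V) :
    spokes u v w = ({u, v} : Finset V).image (fun z => s(w, z)) := by
  simp [spokes, Finset.image_insert]

lemma three_le_card_spokes_union {u v x y : V} (huv : u ≠ v) (hxy : x ≠ y)
    (h : ({u, v} : Finset V) ≠ {x, y}) (w : V) : 3 ≤ #(spokes u v w ∪ spokes x y w) := by
  by_contra! hlt
  have h1 := card_spokes huv w
  have h2 := card_spokes hxy w
  have h3 := Finset.eq_of_subset_of_card_le
    (subset_union_left : spokes u v w ⊆ spokes u v w ∪ spokes x y w) (by omega)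
  have h4 := Finset.eq_of_subset_of_card_le
    (subset_union_right : spokes x y w ⊆ spokes u v w ∪ spokes x y w) (by omega)
  have h5 := h3.trans h4.symm
  rw [spokes_eq_image, spokes_eq_image] at h5
  exact h (Finset.image_injective (fun a b hab => Sym2.congr_right.1 hab) h5)

lemma mem_spokes {u v w : V} {e : Sym2 V} : e ∈ spokes u v w ↔ e = s(w, u) ∨ e = s(w, v) := by
  simp [spokes]

variable {part : V → Fin k} {E : Finset (Sym2 V)} {p : ℝ}

lemma spokes_subset (hE : ∀ u v, s(u, v) ∈ E ↔ part u ≠ part v) {u v w : V}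
    (hw : part w ≠ part u ∧ part w ≠ part v) : spokes u v w ⊆ E := by
  intro e he
  rcases mem_spokes.1 he with rfl | rfl
  · exact (hE _ _).2 hw.1
  · exact (hE _ _).2 hw.2

variable [Fintype V]

lemma subsetExp_isBad (hE : ∀ u v, s(u, v) ∈ E ↔ part u ≠ part v) {u v : V}
    (huv : part u ≠ part v) :
    subsetExp p E (ind (IsBad part u v)) = (1 - p) * (1 - p ^ 2) ^ #(outside part u v) := by
  have hne : u ≠ v := fun h => huv (h ▸ rfl)
  have h1 : ind (IsBad part u v) = fun S => ind (fun S => ¬ {s(u, v)} ⊆ S) S *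
      ∏ w ∈ outside part u v, ind (fun S => ¬ spokes u v w ⊆ S) S := by
    ext S
    rw [← ind_forall, ← ind_and]
    refine congrFun (congrArg ind (funext fun S => propext ?_)) S
    simp [IsBad, outside]
  have h2 : ∀ w ∈ outside part u v,
      subsetExp p E (ind fun S => ¬ spokes u v w ⊆ S) = 1 - p ^ 2 := fun w hw => by
    rw [subsetExp_not_subset, card_spokes hne]
    exact spokes_subset hE (by simpa [outside] using hw)
  rw [h1, subsetExp_mul {s(u, v)}, subsetExp_prod _ (spokes u v),
    subsetExp_not_subset (by simpa using (hE u v).2 huv), Finset.prod_congr rfl h2,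
    Finset.prod_const]
  · simp
  · intro w hw w' hw' hww'
    refine Finset.disjoint_left.2 fun e he he' => ?_
    simp only [outside, coe_filter, mem_univ, true_and, Set.mem_ofPred_eq] at hw hw'
    rw [mem_spokes] at he he'
    rcases he with rfl | rfl <;> rcases he' with h | h <;> rw [Sym2.eq_iff] at h <;> grind
  · intro w _ a ha S
    exact ind_congr (not_congr (subset_insert_iff_of_notMem' ha))
  · intro a ha S
    exact ind_congr (not_congr (subset_insert_iff_of_notMem' ha))
  · intro a ha S
    refine Finset.prod_congr rfl fun w hw => ?_
    simp only [outside, mem_filter, mem_univ, true_and] at hw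
    have : a ∉ spokes u v w := by
      rw [mem_singleton] at ha
      rw [ha, mem_spokes, Sym2.eq_iff, Sym2.eq_iff]
      grind
    exact ind_congr (not_congr (subset_insert_iff_of_notMem' this))

lemma subsetExp_isBad_and_le (hp0 : 0 ≤ p) (hp1 : p ≤ 1)
    (hE : ∀ u v, s(u, v) ∈ E ↔ part u ≠ part v) {u v x y : V}
    (huv : part u ≠ part v) (hxy : part x ≠ part y) (h : ({u, v} : Finset V) ≠ {x, y}) :
    subsetExp p E (ind fun S => IsBad part u v S ∧ IsBad part x y S) ≤
      Real.exp (Fintype.card V * p ^ 3 -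
        (#(outside part u v) + #(outside part x y) - 8 : ℝ) * p ^ 2) := by
  have huv' : u ≠ v := fun h => huv (h ▸ rfl)
  have hxy' : x ≠ y := fun h => hxy (h ▸ rfl)
  set X : Finset V := {u, v, x, y} with hX
  set C : V → Finset (Sym2 V) → Prop := fun w S =>
    (w ∈ outside part u v → ¬ spokes u v w ⊆ S) ∧ (w ∈ outside part x y → ¬ spokes x y w ⊆ S)
    with hC
  have h1 : subsetExp p E (ind fun S => IsBad part u v S ∧ IsBad part x y S) ≤
      ∏ w ∈ univ \ X, subsetExp p E (ind (C w)) := by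
    rw [← subsetExp_prod (univ \ X) (fun w => spokes u v w ∪ spokes x y w)]
    · refine subsetExp_mono hp0 hp1 fun S _ => ?_
      rw [← ind_forall]
      refine ind_mono fun hS w _ => ⟨fun hw => hS.1.2 w ?_, fun hw => hS.2.2 w ?_⟩
      · simpa [outside] using hw
      · simpa [outside] using hw
    · intro w hw w' hw' hww'
      refine Finset.disjoint_left.2 fun e he he' => ?_
      simp only [hX, coe_sdiff, coe_univ, Set.mem_sdiff, Set.mem_univ, true_and, mem_coe,
        mem_insert, mem_singleton, not_or] at hw hw'
      rw [mem_union, mem_spokes, mem_spokes] at he he'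
      rcases he with (rfl | rfl) | (rfl | rfl) <;> rcases he' with (h | h) | (h | h) <;>
        rw [Sym2.eq_iff] at h <;> grind
    · intro w _ a ha S
      rw [mem_union, not_or] at ha
      simp only [ind, hC, subset_insert_iff_of_notMem' ha.1, subset_insert_iff_of_notMem' ha.2]
  set f : V → V → V → ℝ := fun u v w => if w ∈ outside part u v then p ^ 2 else 0 with hf
  have h2 : ∀ w, subsetExp p E (ind (C w)) ≤ Real.exp (p ^ 3 - f u v w - f x y w) := by
    intro w
    refine le_trans ?_ (Real.add_one_le_exp _)
    have hp3 : 0 ≤ p ^ 3 := by positivity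
    by_cases ha : w ∈ outside part u v <;> by_cases hb : w ∈ outside part x y <;>
      simp only [hC, hf, ha, hb, true_implies, false_implies, and_true, true_and, if_true, if_false]
    · rw [subsetExp_not_subset_and (spokes_subset hE (by simpa [outside] using ha))
        (spokes_subset hE (by simpa [outside] using hb)), card_spokes huv', card_spokes hxy']
      have := pow_le_pow_of_le_one hp0 hp1 (three_le_card_spokes_union huv' hxy' h w)
      linarith
    · rw [subsetExp_not_subset (spokes_subset hE (by simpa [outside] using ha)),
        card_spokes huv']
      linarith
    · rw [subsetExp_not_subset (spokes_subset hE (by simpa [outside] using hb)),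
        card_spokes hxy']
      linarith
    · have : (ind fun _ : Finset (Sym2 V) => True) = fun _ => 1 := by ext; simp [ind]
      rw [this, subsetExp_one]
      linarith
  have h3 : ∀ u v, (#(outside part u v) - 4 : ℝ) * p ^ 2 ≤ ∑ w ∈ univ \ X, f u v w := by
    intro u v
    have h4 : ∑ w, f u v w = #(outside part u v) * p ^ 2 := by
      simp [hf, Finset.sum_ite_mem]
    have h5 : ∑ w ∈ X, f u v w ≤ 4 * p ^ 2 := by
      calc ∑ w ∈ X, f u v w ≤ ∑ w ∈ X, p ^ 2 := Finset.sum_le_sum fun w _ => by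
            simp only [hf]; split_ifs; exacts [le_rfl, sq_nonneg p]
        _ = #X * p ^ 2 := by simp
        _ ≤ 4 * p ^ 2 := by
            have : #X ≤ 4 := Finset.card_le_four
            gcongr
            exact_mod_cast this
    have h6 := Finset.sum_sdiff (subset_univ X) (f := f u v)
    linarith
  have h4 : ∑ w ∈ univ \ X, p ^ 3 ≤ Fintype.card V * p ^ 3 := by
    rw [Finset.sum_const, nsmul_eq_mul]
    gcongr
    exact Finset.card_le_univ _
  calc _ ≤ ∏ w ∈ univ \ X, subsetExp p E (ind (C w)) := h1
    _ ≤ ∏ w ∈ univ \ X, Real.exp (p ^ 3 - f u v w - f x y w) := by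
        refine Finset.prod_le_prod (fun w _ => ?_) fun w _ => h2 w
        have := subsetExp_mono (E := E) hp0 hp1 (F := fun _ => 0 * 1) (G := ind (C w))
          fun S _ => by unfold ind; split_ifs <;> simp
        rwa [subsetExp_const_mul, zero_mul] at this
    _ ≤ _ := by
        rw [← Real.exp_sum, Real.exp_le_exp, Finset.sum_sub_distrib, Finset.sum_sub_distrib]
        linarith [h3 u v, h3 x y]

/-- The ordered pairs of vertices in distinct partite sets, ordered by partite set. -/
def crossOrdered (part : V → Fin k) : Finset (V × V) :=
  univ.filter fun q : V × V => part q.1 < part q.2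

lemma subsetExp_no_isBad_le (hp0 : 0 < p) (hp1 : p ≤ 1 / 2)
    (hE : ∀ u v, s(u, v) ∈ E ↔ part u ≠ part v) (hQ : (crossOrdered part).Nonempty) {M : ℕ}
    (hM : ∀ u v, part u ≠ part v → #(outside part u v) ≤ M) :
    subsetExp p E (ind fun S => ∀ q ∈ crossOrdered part, ¬ IsBad part q.1 q.2 S) ≤
      (#(crossOrdered part) * ((1 - p) * (1 - p ^ 2) ^ M))⁻¹ +
      (((1 - p) ^ 2)⁻¹ * Real.exp (8 * p ^ 2 + Fintype.card V * p ^ 3 +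
        2 * Fintype.card V * p ^ 4) - 1) := by
  have hpp : p ^ 2 ≤ (1 / 2) ^ 2 := by gcongr
  have hq0 : 0 < 1 - p := by linarith
  have hqq0 : 0 < 1 - p ^ 2 := by linarith
  have hsum : #(crossOrdered part) * ((1 - p) * (1 - p ^ 2) ^ M) ≤
      ∑ q ∈ crossOrdered part, subsetExp p E (ind (IsBad part q.1 q.2)) := by
    rw [← nsmul_eq_mul, ← Finset.sum_const]
    refine Finset.sum_le_sum fun q hq => ?_
    have hq' : part q.1 ≠ part q.2 := (by simpa [crossOrdered] using hq : _ < _).ne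
    rw [subsetExp_isBad hE hq']
    refine mul_le_mul_of_nonneg_left ?_ hq0.le
    exact pow_le_pow_of_le_one hqq0.le (by linarith [sq_nonneg p]) (hM _ _ hq')
  have hpos : 0 < #(crossOrdered part) * ((1 - p) * (1 - p ^ 2) ^ M) := by
    have : 0 < #(crossOrdered part) := Finset.card_pos.2 hQ
    positivity
  have hδ : 1 ≤ ((1 - p) ^ 2)⁻¹ * Real.exp (8 * p ^ 2 + Fintype.card V * p ^ 3 +
        2 * Fintype.card V * p ^ 4) := by
    refine one_le_mul_of_one_le_of_one_le ?_ (Real.one_le_exp (by positivity))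
    exact (one_le_inv₀ (by positivity)).2 (pow_le_one₀ hq0.le (by linarith))
  refine (subsetExp_none_le hp0.le (by linarith) (crossOrdered part)
    (fun q => IsBad part q.1 q.2) (sub_nonneg.2 hδ) (hpos.trans_le hsum) ?_).trans ?_
  · rintro ⟨u, v⟩ hq ⟨x, y⟩ hr hne
    simp only [crossOrdered, mem_filter, mem_univ, true_and] at hq hr
    have hset : ({u, v} : Finset V) ≠ {x, y} := by
      intro hs
      have h1 : u ∈ ({x, y} : Finset V) := hs ▸ by simp
      have h2 : v ∈ ({x, y} : Finset V) := hs ▸ by simp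
      simp only [mem_insert, mem_singleton] at h1 h2
      rcases h1 with rfl | rfl <;> rcases h2 with rfl | rfl
      · exact hq.false
      · exact hne rfl
      · exact (hq.trans hr).false
      · exact hq.false
    refine (subsetExp_isBad_and_le hp0.le (by linarith) hE hq.ne hr.ne hset).trans ?_
    rw [subsetExp_isBad hE hq.ne, subsetExp_isBad hE hr.ne]
    set a := #(outside part u v)
    set b := #(outside part x y)
    have ha : (a : ℝ) ≤ Fintype.card V := by exact_mod_cast Finset.card_le_univ _
    have hb : (b : ℝ) ≤ Fintype.card V := by exact_mod_cast Finset.card_le_univ _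
    have hexp : Real.exp ((a + b : ℕ) * (-(p ^ 2 + (p ^ 2) ^ 2))) ≤ (1 - p ^ 2) ^ (a + b) := by
      rw [Real.exp_nat_mul]
      gcongr
      exact exp_le_one_sub (by positivity) (by linarith)
    have e1 : (1 + (((1 - p) ^ 2)⁻¹ * Real.exp (8 * p ^ 2 + Fintype.card V * p ^ 3 +
        2 * Fintype.card V * p ^ 4) - 1)) *
        ((1 - p) * (1 - p ^ 2) ^ a * ((1 - p) * (1 - p ^ 2) ^ b)) =
        Real.exp (8 * p ^ 2 + Fintype.card V * p ^ 3 +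
        2 * Fintype.card V * p ^ 4) * (1 - p ^ 2) ^ (a + b) := by
      rw [pow_add]
      field_simp
      ring
    rw [e1]
    refine le_trans ?_ (mul_le_mul_of_nonneg_left hexp (Real.exp_pos _).le)
    rw [← Real.exp_add, Real.exp_le_exp]
    push_cast
    have : ((a : ℝ) + b) * p ^ 4 ≤ 2 * Fintype.card V * p ^ 4 := by
      gcongr
      linarith
    linarith
  · gcongr

lemma sum_diam_two_le (hp0 : 0 ≤ p) (hp1 : p ≤ 1) (part : V → Fin k) :
    (∑ G : SimpleGraph V,
      if (∀ u v, G.Adj u v → part u ≠ part v) ∧ G.Connected ∧ ∀ u v, G.dist u v ≤ 2 then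
        p ^ Nat.card G.edgeSet * (1 - p) ^ (#(crossOrdered part) - Nat.card G.edgeSet)
      else 0) ≤
    subsetExp p ((crossOrdered part).image fun q => s(q.1, q.2))
      (ind fun S => ∀ q ∈ crossOrdered part, ¬ IsBad part q.1 q.2 S) := by
  set E := (crossOrdered part).image fun q => s(q.1, q.2) with hE
  have hcard : #E = #(crossOrdered part) := by
    refine Finset.card_image_of_injOn ?_
    rintro ⟨u, v⟩ hq ⟨x, y⟩ hr h
    simp only [crossOrdered, coe_filter, mem_univ, true_and, Set.mem_ofPred_eq] at hq hr
    rcases Sym2.eq_iff.1 h with ⟨h1, h2⟩ | ⟨h1, h2⟩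
    · exact Prod.ext h1 h2
    · dsimp only at h1 h2
      subst h1 h2
      exact absurd (hq.trans hr) (lt_irrefl _)
  have hEmem : ∀ u v, part u ≠ part v → s(u, v) ∈ E := by
    intro u v h
    rcases lt_or_gt_of_ne h with h | h
    · exact Finset.mem_image.2 ⟨(u, v), by simpa [crossOrdered] using h, rfl⟩
    · exact Finset.mem_image.2 ⟨(v, u), by simpa [crossOrdered] using h, Sym2.eq_swap⟩
  rw [← Finset.sum_filter, subsetExp]
  have hinj : Function.Injective (fun G : SimpleGraph V => G.edgeSet.toFinset) := by
    intro G H h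
    exact SimpleGraph.edgeSet_injective (Set.toFinset_inj.1 h)
  set Z := univ.filter (fun G : SimpleGraph V =>
    (∀ u v, G.Adj u v → part u ≠ part v) ∧ G.Connected ∧ ∀ u v, G.dist u v ≤ 2) with hZ
  have hsub : Z.image (fun G : SimpleGraph V => G.edgeSet.toFinset) ⊆ E.powerset := by
    intro S hS
    obtain ⟨G, hG, rfl⟩ := Finset.mem_image.1 hS
    rw [mem_powerset]
    intro e he
    induction e with
    | h u v =>
      rw [Set.mem_toFinset, SimpleGraph.mem_edgeSet] at he
      exact hEmem u v ((Finset.mem_filter.1 hG).2.1 u v he)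
  refine le_trans ?_ (Finset.sum_le_sum_of_subset_of_nonneg hsub fun S _ _ => ?_)
  · rw [Finset.sum_image hinj.injOn]
    refine Finset.sum_le_sum fun G hG => ?_
    obtain ⟨hG1, hG2, hG3⟩ := (Finset.mem_filter.1 hG).2
    have h1 : ind (fun S => ∀ q ∈ crossOrdered part, ¬ IsBad part q.1 q.2 S)
        G.edgeSet.toFinset = 1 := by
      refine if_pos ?_
      rintro ⟨u, v⟩ hq ⟨hb1, hb2⟩
      have hne : part u < part v := by simpa [crossOrdered] using hq
      simp only [Set.mem_toFinset, SimpleGraph.mem_edgeSet] at hb1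
      obtain ⟨W, hW⟩ := hG2.exists_walk_length_eq_dist u v
      have hle : W.length ≤ 2 := hW ▸ hG3 u v
      match W, hle with
      | .nil, _ => exact hne.false
      | .cons h .nil, _ => exact hb1 h
      | .cons (v := w) h (.cons h' .nil), _ =>
        refine hb2 w ⟨(hG1 _ _ h).symm, hG1 _ _ h'⟩ fun e he => ?_
        rw [Set.mem_toFinset]
        rcases mem_spokes.1 he with rfl | rfl
        · exact h.symm
        · exact h'
      | .cons _ (.cons _ (.cons _ _)), h => simp at h
    have h2 : Nat.card G.edgeSet = #G.edgeSet.toFinset := by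
      rw [Nat.card_coe_set_eq, Set.ncard_eq_toFinset_card']
    rw [h1, mul_one, hcard, h2]
  · have : 0 ≤ 1 - p := by linarith
    have : 0 ≤ ind (fun S => ∀ q ∈ crossOrdered part, ¬ IsBad part q.1 q.2 S) S := by
      unfold ind; split_ifs <;> simp
    positivity

lemma sum_diam_two_le_of_outside (hp0 : 0 < p) (hp1 : p ≤ 1 / 2) (part : V → Fin k)
    (hQ : (crossOrdered part).Nonempty) {M : ℕ}
    (hM : ∀ u v, part u ≠ part v → #(outside part u v) ≤ M) :
    (∑ G : SimpleGraph V,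
      if (∀ u v, G.Adj u v → part u ≠ part v) ∧ G.Connected ∧ ∀ u v, G.dist u v ≤ 2 then
        p ^ Nat.card G.edgeSet * (1 - p) ^ (#(crossOrdered part) - Nat.card G.edgeSet)
      else 0) ≤
      (#(crossOrdered part) * ((1 - p) * (1 - p ^ 2) ^ M))⁻¹ +
      (((1 - p) ^ 2)⁻¹ * Real.exp (8 * p ^ 2 + Fintype.card V * p ^ 3 +
        2 * Fintype.card V * p ^ 4) - 1) := by
  refine (sum_diam_two_le hp0.le (by linarith) part).trans (subsetExp_no_isBad_le hp0 hp1 ?_ hQ hM)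
  intro u v
  simp only [mem_image, crossOrdered, mem_filter, mem_univ, true_and, Prod.exists, Sym2.eq_iff]
  constructor
  · rintro ⟨a, b, hab, ⟨rfl, rfl⟩ | ⟨rfl, rfl⟩⟩
    · exact hab.ne
    · exact hab.ne'
  · intro h
    rcases lt_or_gt_of_ne h with h | h
    · exact ⟨u, v, h, Or.inl ⟨rfl, rfl⟩⟩
    · exact ⟨v, u, h, Or.inr ⟨rfl, rfl⟩⟩

end bad

section turan

variable {k : ℕ}

lemma card_crossOrdered (sz : Fin k → ℕ) :
    #(crossOrdered (Sigma.fst : (Σ i : Fin k, Fin (sz i)) → Fin k)) = crossPairs k sz := by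
  rw [crossOrdered, Finset.card_filter, Fintype.sum_prod_type, Fintype.sum_sigma, crossPairs]
  refine Finset.sum_congr rfl fun i _ => ?_
  calc _ = ∑ _a : Fin (sz i), ∑ j : Fin k, ∑ _b : Fin (sz j), (if i < j then 1 else 0) := by
        refine Finset.sum_congr rfl fun a _ => ?_
        rw [Fintype.sum_sigma]
    _ = _ := by
        simp only [Finset.sum_const, card_univ, Fintype.card_fin, smul_eq_mul, Finset.mul_sum]
        refine Finset.sum_congr rfl fun j _ => ?_
        split_ifs <;> simp

lemma card_outside_le (sz : Fin k → ℕ) {m : ℕ} (hm : ∀ i, m ≤ sz i)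
    (u v : Σ i : Fin k, Fin (sz i)) (huv : u.1 ≠ v.1) :
    #(outside (Sigma.fst : (Σ i : Fin k, Fin (sz i)) → Fin k) u v) ≤ ∑ i, sz i - 2 * m := by
  have h : ∀ i, #(univ.filter fun w : Σ i : Fin k, Fin (sz i) => w.1 = i) = sz i := by
    intro i
    have : (univ.filter fun w : Σ i : Fin k, Fin (sz i) => w.1 = i) =
        univ.map (Function.Embedding.sigmaMk i) := by
      ext ⟨j, a⟩
      simp only [mem_filter, mem_univ, true_and, mem_map, Function.Embedding.sigmaMk_apply]
      constructor
      · rintro rfl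
        exact ⟨a, rfl⟩
      · rintro ⟨b, hb⟩
        exact (congrArg Sigma.fst hb).symm
    rw [this, card_map, card_univ, Fintype.card_fin]
  have hdisj : Disjoint (univ.filter fun w : Σ i : Fin k, Fin (sz i) => w.1 = u.1)
      (univ.filter fun w => w.1 = v.1) := by
    refine Finset.disjoint_left.2 fun w hw hw' => huv ?_
    rw [← (mem_filter.1 hw).2, (mem_filter.1 hw').2]
  have hsub : outside (Sigma.fst : (Σ i : Fin k, Fin (sz i)) → Fin k) u v ⊆
      univ \ ((univ.filter fun w => w.1 = u.1) ∪ (univ.filter fun w => w.1 = v.1)) := by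
    intro w hw
    simpa [outside] using hw
  refine (Finset.card_le_card hsub).trans ?_
  rw [Finset.card_sdiff_of_subset (subset_univ _), Finset.card_union_of_disjoint hdisj, h, h,
    card_univ, Fintype.card_sigma]
  simp only [Fintype.card_fin]
  have := hm u.1
  have := hm v.1
  omega

lemma le_two_mul_crossPairs (sz : Fin k → ℕ) {m : ℕ} (hm : ∀ i, m ≤ sz i) :
    k * (k - 1) * m ^ 2 ≤ 2 * crossPairs k sz := by
  have h1 : ∑ j : Fin k, ∑ i : Fin k, (if i < j then m * m else 0) = k * (k - 1) / 2 * m ^ 2 := by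
    simp_rw [← Finset.sum_filter, Finset.sum_const]
    have : ∀ j : Fin k, #(univ.filter fun i => i < j) = j := fun j => by
      rw [← Fin.card_Iio j]
      congr 1
      ext
      simp
    simp_rw [this, ← Finset.sum_smul, Fin.sum_univ_eq_sum_range (fun i => i) k,
      Finset.sum_range_id]
    rw [smul_eq_mul, sq]
  rw [Finset.sum_comm] at h1
  have h2 : k * (k - 1) / 2 * m ^ 2 ≤ crossPairs k sz := by
    rw [← h1, crossPairs]
    refine Finset.sum_le_sum fun i _ => Finset.sum_le_sum fun j _ => ?_
    split_ifs
    · exact Nat.mul_le_mul (hm i) (hm j)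
    · exact le_rfl
  have h3 := Nat.div_mul_cancel (Nat.even_mul_pred_self k).two_dvd
  nlinarith

lemma sum_turanSizes (hk : 0 < k) (n : ℕ) : ∑ i, turanSizes k n i = n := by
  have h : ∀ i : Fin k, turanSizes k n i = n / k + if (i : ℕ) < n % k then 1 else 0 := by
    intro i
    unfold turanSizes
    split_ifs <;> rfl
  simp_rw [h, Finset.sum_add_distrib]
  rw [Fin.sum_univ_eq_sum_range (fun i => if i < n % k then 1 else 0) k, ← Finset.card_filter]
  have : (range k).filter (fun i => i < n % k) = range (n % k) := by
    ext i
    have := Nat.mod_lt n hk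
    simp only [mem_filter, mem_range]
    omega
  rw [this]
  simp [Nat.div_add_mod]

lemma div_le_turanSizes (n : ℕ) (i : Fin k) : n / k ≤ turanSizes k n i := by
  unfold turanSizes
  split_ifs <;> omega

lemma turanKpartiteDiam2Prob_le {p : ℝ} (hp0 : 0 < p) (hp1 : p ≤ 1 / 2) (hk : 2 ≤ k) {n : ℕ}
    (hn : k ≤ n) :
    turanKpartiteDiam2Prob k n p ≤
      (crossPairs k (turanSizes k n) * ((1 - p) * (1 - p ^ 2) ^ (n - 2 * (n / k))))⁻¹ +
      (((1 - p) ^ 2)⁻¹ * Real.exp (8 * p ^ 2 + n * p ^ 3 + 2 * n * p ^ 4) - 1) := by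
  have hsum := sum_turanSizes (show 0 < k by omega) n
  have hpos : 0 < n / k := Nat.div_pos hn (by omega)
  have hcp := le_two_mul_crossPairs (turanSizes k n) (div_le_turanSizes n)
  have hQ : (crossOrdered (Sigma.fst : (Σ i : Fin k, Fin (turanSizes k n i)) → Fin k)).Nonempty := by
    rw [← Finset.card_pos, card_crossOrdered]
    have : 0 < k * (k - 1) * (n / k) ^ 2 := by
      have : 0 < k - 1 := by omega
      positivity
    omega
  have h := sum_diam_two_le_of_outside hp0 hp1 _ hQ fun u v huv =>
    card_outside_le (turanSizes k n) (div_le_turanSizes n) u v huv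
  rw [card_crossOrdered, hsum, Fintype.card_sigma] at h
  simp only [Fintype.card_fin, hsum] at h
  rw [turanKpartiteDiam2Prob, kpartiteDiam2Prob]
  convert h using 2
  · congr!
  · congr

end turan

section asymptotics

open Filter Topology

lemma turanKpartiteDiam2Prob_le_exp {k n : ℕ} {p : ℝ} (hp0 : 0 < p) (hp1 : p ≤ 1 / 2)
    (hk : 2 ≤ k) (hn : k < n) :
    turanKpartiteDiam2Prob k n p ≤
      (((k : ℝ) - 1) / (2 * k) * (n - k) ^ 2 * (1 - p) *
        Real.exp (-((n * (1 - 2 / k) + 2) * (p ^ 2 + p ^ 4))))⁻¹ +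
      (((1 - p) ^ 2)⁻¹ * Real.exp (8 * p ^ 2 + n * p ^ 3 + 2 * n * p ^ 4) - 1) := by
  refine (turanKpartiteDiam2Prob_le hp0 hp1 hk hn.le).trans ?_
  have hk2 : (2 : ℝ) ≤ k := by exact_mod_cast hk
  have hnk : (k : ℝ) < n := by exact_mod_cast hn
  have hq : 0 < 1 - p := by linarith
  have hp2 : p ^ 2 ≤ (1 / 2) ^ 2 := by gcongr
  have hdiv : (n : ℝ) / k - 1 ≤ (n / k : ℕ) := by
    have h1 : n < (n / k + 1) * k := (Nat.div_lt_iff_lt_mul (by omega)).1 (Nat.lt_succ_self _)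
    have h2 : (n : ℝ) < ((n / k : ℕ) + 1) * k := by exact_mod_cast h1
    rw [sub_le_iff_le_add, div_le_iff₀ (by linarith)]
    exact h2.le
  have hdiv0 : 0 ≤ (n : ℝ) / k - 1 := by
    rw [sub_nonneg, le_div_iff₀ (by linarith)]
    linarith
  have hcp : ((k : ℝ) - 1) / (2 * k) * (n - k) ^ 2 ≤ crossPairs k (turanSizes k n) := by
    have h1 := le_two_mul_crossPairs (turanSizes k n) (div_le_turanSizes n)
    have h2 : (k : ℝ) * (k - 1) * (n / k : ℕ) ^ 2 ≤ 2 * crossPairs k (turanSizes k n) := by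
      have h3 : ((k * (k - 1) * (n / k) ^ 2 : ℕ) : ℝ) ≤ (2 * crossPairs k (turanSizes k n) : ℕ) :=
        by exact_mod_cast h1
      push_cast [Nat.cast_sub (show 1 ≤ k by omega)] at h3
      exact_mod_cast h3
    have h4 : (k : ℝ) * (k - 1) * ((n : ℝ) / k - 1) ^ 2 ≤ k * (k - 1) * (n / k : ℕ) ^ 2 := by
      have : (0 : ℝ) ≤ k - 1 := by linarith
      gcongr
    have h5 : (k : ℝ) * (k - 1) * ((n : ℝ) / k - 1) ^ 2 =
        2 * ((k - 1) / (2 * k) * (n - k) ^ 2) := by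
      field_simp
    linarith
  have hexp : Real.exp (-((n * (1 - 2 / k) + 2) * (p ^ 2 + p ^ 4))) ≤
      (1 - p ^ 2) ^ (n - 2 * (n / k)) := by
    have h1 : Real.exp ((n - 2 * (n / k) : ℕ) * (-(p ^ 2 + (p ^ 2) ^ 2))) ≤
        (1 - p ^ 2) ^ (n - 2 * (n / k)) := by
      rw [Real.exp_nat_mul]
      gcongr
      exact exp_le_one_sub (by positivity) (by linarith)
    refine le_trans (Real.exp_le_exp.2 ?_) h1
    have h2 : 2 * (n / k) ≤ n :=
      (Nat.mul_le_mul_right _ hk).trans (Nat.mul_div_le n k)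
    have h3 : ((n - 2 * (n / k) : ℕ) : ℝ) ≤ n * (1 - 2 / k) + 2 := by
      rw [Nat.cast_sub h2]
      push_cast
      have : (n : ℝ) * (1 - 2 / k) = n - 2 * (n / k) := by ring
      linarith
    have h4 : ((n - 2 * (n / k) : ℕ) : ℝ) * (p ^ 2 + p ^ 4) ≤
        (n * (1 - 2 / k) + 2) * (p ^ 2 + p ^ 4) := by gcongr
    linarith
  have hk1 : (0 : ℝ) < k - 1 := by linarith
  have hnk' : (0 : ℝ) < n - k := by linarith
  rw [mul_assoc _ (1 - p)]
  gcongr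

variable {k : ℕ} {p : ℕ → ℝ} {c : ℝ}

/-- The logarithm of the asymptotic expected number of pairs of vertices at distance greater
than two. -/
noncomputable def critSeq (k : ℕ) (p : ℕ → ℝ) (n : ℕ) : ℝ :=
  2 * Real.log n - Real.log k - (n : ℝ) * (p n) ^ 2 * (1 - 1 / (k : ℝ)) -
    Real.log 2 +
    Real.log (1 + ((k : ℝ) - 1) * Real.exp ((n : ℝ) * (p n) ^ 2 / (k : ℝ)))

lemma tendsto_log_natCast_atTop : Tendsto (fun n : ℕ => Real.log n) atTop atTop :=
  Real.tendsto_log_atTop.comp tendsto_natCast_atTop_atTop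

lemma tendsto_mul_sq_atTop (hk : 3 ≤ k) (hconv : Tendsto (critSeq k p) atTop (𝓝 c)) :
    Tendsto (fun n : ℕ => (n : ℝ) * p n ^ 2) atTop atTop := by
  have hk3 : (3 : ℝ) ≤ k := by exact_mod_cast hk
  have h1 : Tendsto (fun n : ℕ => 2 * Real.log n + (-critSeq k p n - Real.log k - Real.log 2))
      atTop atTop :=
    ((tendsto_log_natCast_atTop.const_mul_atTop two_pos).atTop_add
      ((hconv.neg.sub_const _).sub_const _))
  refine tendsto_atTop_mono (fun n => ?_) h1
  set t := (n : ℝ) * p n ^ 2 with ht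
  have ht0 : 0 ≤ t := by positivity
  have h2 : 0 ≤ Real.log (1 + ((k : ℝ) - 1) * Real.exp (t / k)) := by
    have : 0 ≤ ((k : ℝ) - 1) * Real.exp (t / k) :=
      mul_nonneg (by linarith) (Real.exp_pos _).le
    exact Real.log_nonneg (by linarith)
  have h3 : 0 ≤ t / k := by positivity
  have h4 : t * (1 - 1 / k) = t - t / k := by ring
  rw [critSeq, ← ht, h4]
  linarith

lemma tendsto_mul_cube (hk : 3 ≤ k) (hp : ∀ n, 0 < p n) (hc : 0 < c)
    (hconv : Tendsto (critSeq k p) atTop (𝓝 c)) :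
    Tendsto (fun n : ℕ => (n : ℝ) * p n ^ 3) atTop (𝓝 0) := by
  have hk3 : (3 : ℝ) ≤ k := by exact_mod_cast hk
  have h1 : ∀ᶠ n : ℕ in atTop, (n : ℝ) * p n ^ 2 ≤ 6 * Real.log n := by
    filter_upwards [hconv.eventually_const_lt hc] with n hn
    set t := (n : ℝ) * p n ^ 2 with ht
    have ht0 : 0 ≤ t := by positivity
    have h2 : Real.log (1 + ((k : ℝ) - 1) * Real.exp (t / k)) ≤ Real.log k + t / k := by
      rw [← Real.log_exp (t / k), ← Real.log_mul (by positivity) (Real.exp_pos _).ne',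
        Real.log_exp]
      have h3 : 0 < (k : ℝ) - 1 := by linarith
      refine Real.log_le_log (by positivity) ?_
      have : 1 ≤ Real.exp (t / k) := Real.one_le_exp (by positivity)
      linarith
    have h4 : t / k ≤ t / 3 := by gcongr
    have h5 : t * (1 - 1 / k) = t - t / k := by ring
    have h6 := Real.log_pos (show (1 : ℝ) < 2 by norm_num)
    unfold critSeq at hn
    rw [← ht, h5] at hn
    linarith
  have h2 : Tendsto (fun n : ℕ => 216 * (Real.log n ^ 3 / n)) atTop (𝓝 0) := by
    have := (Real.isLittleO_pow_log_id_atTop (n := 3)).tendsto_div_nhds_zero.comp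
      tendsto_natCast_atTop_atTop
    simpa using this.const_mul 216
  have h3 : Tendsto (fun n : ℕ => ((n : ℝ) * p n ^ 3) ^ 2) atTop (𝓝 0) := by
    refine squeeze_zero' (Eventually.of_forall fun n => sq_nonneg _) ?_ h2
    filter_upwards [h1, eventually_gt_atTop 0] with n hn hn0
    have hn0' : (0 : ℝ) < n := by exact_mod_cast hn0
    have h4 : ((n : ℝ) * p n ^ 2) ^ 3 ≤ (6 * Real.log n) ^ 3 := by gcongr
    calc ((n : ℝ) * p n ^ 3) ^ 2 = ((n : ℝ) * p n ^ 2) ^ 3 / n := by field_simp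
      _ ≤ (6 * Real.log n) ^ 3 / n := by gcongr
      _ = 216 * (Real.log n ^ 3 / n) := by ring
  have h4 := h3.sqrt
  rw [Real.sqrt_zero] at h4
  refine h4.congr fun n => Real.sqrt_sq ?_
  have := hp n
  positivity

lemma tendsto_zero_of_mul_pow_four (hp : ∀ n, 0 < p n)
    (hp4 : Tendsto (fun n : ℕ => (n : ℝ) * p n ^ 4) atTop (𝓝 0)) :
    Tendsto p atTop (𝓝 0) := by
  have h1 : Tendsto (fun n => p n ^ 4) atTop (𝓝 0) := by
    refine squeeze_zero' (Eventually.of_forall fun n => by have := hp n; positivity) ?_ hp4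
    filter_upwards [eventually_ge_atTop 1] with n hn
    have hn' : (1 : ℝ) ≤ n := by exact_mod_cast hn
    exact le_mul_of_one_le_left (by have := hp n; positivity) hn'
  have h2 := h1.sqrt.sqrt
  rw [Real.sqrt_zero, Real.sqrt_zero] at h2
  refine h2.congr fun n => ?_
  rw [show p n ^ 4 = (p n ^ 2) ^ 2 by ring, Real.sqrt_sq (by positivity), Real.sqrt_sq (hp n).le]

lemma tendsto_expected_crossPairs (hk : 3 ≤ k) (hconv : Tendsto (critSeq k p) atTop (𝓝 c)) :
    Tendsto (fun n : ℕ => ((k : ℝ) - 1) / (2 * k) * n ^ 2 *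
      Real.exp (-(n * p n ^ 2 * (1 - 2 / k)))) atTop (𝓝 (Real.exp c)) := by
  have hk3 : (3 : ℝ) ≤ k := by exact_mod_cast hk
  have hk1 : (0 : ℝ) < k - 1 := by linarith
  have h1 : Tendsto (fun n : ℕ => 1 + Real.exp (-(n * p n ^ 2 / k)) / (k - 1)) atTop (𝓝 1) := by
    have h2 : Tendsto (fun n : ℕ => (n : ℝ) * p n ^ 2 / k) atTop atTop :=
      (tendsto_mul_sq_atTop hk hconv).atTop_div_const (by linarith)
    have h3 := (Real.tendsto_exp_neg_atTop_nhds_zero.comp h2).div_const ((k : ℝ) - 1)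
    simpa using h3.const_add 1
  have h4 := ((Real.continuous_exp.tendsto c).comp hconv).div h1 one_ne_zero
  rw [div_one] at h4
  refine h4.congr' ?_
  filter_upwards [eventually_gt_atTop 0] with n hn
  have hn' : (0 : ℝ) < n := by exact_mod_cast hn
  simp only [Pi.div_apply, Function.comp_apply]
  rw [div_eq_iff (by positivity)]
  have h5 : Real.exp (critSeq k p n) = n ^ 2 / (2 * k) * Real.exp (-(n * p n ^ 2 * (1 - 1 / k))) *
      (1 + (k - 1) * Real.exp (n * p n ^ 2 / k)) := by
    have h6 : critSeq k p n = Real.log (n ^ 2 / (2 * k)) + -(n * p n ^ 2 * (1 - 1 / k)) +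
        Real.log (1 + (k - 1) * Real.exp (n * p n ^ 2 / k)) := by
      rw [Real.log_div (by positivity) (by positivity), Real.log_pow,
        Real.log_mul (by positivity) (by positivity), critSeq]
      push_cast
      ring
    rw [h6, Real.exp_add, Real.exp_add, Real.exp_log (by positivity), Real.exp_log (by positivity)]
  set x := (n : ℝ) * p n ^ 2 / k with hx
  have h7 : -((n : ℝ) * p n ^ 2 * (1 - 2 / k)) = -(n * p n ^ 2 * (1 - 1 / k)) + x := by
    rw [hx]; ring
  rw [h5, h7, Real.exp_add, Real.exp_neg x]
  have := Real.exp_pos x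
  field_simp
  ring

end asymptotics

end SecondMoment

/-- If `n p(n)⁴ → 0` and the critical sequence tends to `c > 0`, then for every
`ε > 0`, for all large `n`, `P_k^t(n, p(n)) ≤ (1+ε) e^{-c}`. -/
theorem turanKpartiteDiam2Prob_upper_critical (k : ℕ) (hk : 3 ≤ k)
    (p : ℕ → ℝ) (hp : ∀ n, p n ∈ Set.Ioo (0 : ℝ) 1)
    (hp4 : Filter.Tendsto (fun n : ℕ => (n : ℝ) * (p n) ^ 4) Filter.atTop (nhds 0))
    (c : ℝ) (hc : 0 < c)
    (hconv : Filter.Tendsto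
      (fun n : ℕ =>
        2 * Real.log n - Real.log k - (n : ℝ) * (p n) ^ 2 * (1 - 1 / (k : ℝ)) -
          Real.log 2 +
          Real.log (1 + ((k : ℝ) - 1) * Real.exp ((n : ℝ) * (p n) ^ 2 / (k : ℝ))))
      Filter.atTop (nhds c)) :
    ∀ ε > (0 : ℝ), ∃ N : ℕ, ∀ n ≥ N,
      turanKpartiteDiam2Prob k n (p n) ≤ (1 + ε) * Real.exp (-c) := by
  intro ε hε
  have hp0 : ∀ n, 0 < p n := fun n => (hp n).1
  have hpt := tendsto_zero_of_mul_pow_four hp0 hp4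
  have hp3 := tendsto_mul_cube hk hp0 hc hconv
  have hp2t : Filter.Tendsto (fun n => p n ^ 2) Filter.atTop (nhds 0) := by
    simpa using hpt.pow 2
  have hp4t : Filter.Tendsto (fun n => p n ^ 4) Filter.atTop (nhds 0) := by
    simpa using hpt.pow 4
  have hδ : Filter.Tendsto (fun n : ℕ => ((1 - p n) ^ 2)⁻¹ *
      Real.exp (8 * p n ^ 2 + n * p n ^ 3 + 2 * n * p n ^ 4) - 1) Filter.atTop (nhds 0) := by
    have h1 : Filter.Tendsto (fun n : ℕ => ((1 - p n) ^ 2)⁻¹) Filter.atTop (nhds 1) := by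
      simpa using ((hpt.const_sub 1).pow 2).inv₀ (by norm_num)
    have h2 : Filter.Tendsto (fun n : ℕ => 8 * p n ^ 2 + n * p n ^ 3 + 2 * n * p n ^ 4)
        Filter.atTop (nhds 0) := by
      have := ((hp2t.const_mul 8).add hp3).add (hp4.const_mul 2)
      simpa [mul_assoc] using this
    have h3 := (h1.mul h2.rexp).sub_const 1
    simpa using h3
  have hm : Filter.Tendsto (fun n : ℕ => ((k : ℝ) - 1) / (2 * k) * (n - k) ^ 2 * (1 - p n) *
        Real.exp (-((n * (1 - 2 / k) + 2) * (p n ^ 2 + p n ^ 4)))) Filter.atTop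
        (nhds (Real.exp c)) := by
    have h1 : Filter.Tendsto (fun n : ℕ => (1 - (k : ℝ) / n) ^ 2) Filter.atTop (nhds 1) := by
      simpa using ((tendsto_const_div_atTop_nhds_zero_nat (k : ℝ)).const_sub 1).pow 2
    have h2 : Filter.Tendsto (fun n : ℕ => -(2 * p n ^ 2 + ((1 - 2 / k) * (n * p n ^ 4) +
        2 * p n ^ 4))) Filter.atTop (nhds 0) := by
      simpa using ((hp2t.const_mul 2).add
        ((hp4.const_mul (1 - 2 / (k : ℝ))).add (hp4t.const_mul 2))).neg
    have h3 := (((tendsto_expected_crossPairs hk hconv).mul h1).mul (hpt.const_sub 1)).mul h2.rexp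
    simp only [sub_zero, Real.exp_zero, mul_one] at h3
    refine h3.congr' ?_
    filter_upwards [Filter.eventually_gt_atTop 0] with n hn
    have hn' : (n : ℝ) ≠ 0 := by exact_mod_cast hn.ne'
    have h4 : -((n * (1 - 2 / k) + 2) * (p n ^ 2 + p n ^ 4)) =
        -((n : ℝ) * p n ^ 2 * (1 - 2 / k)) +
        -(2 * p n ^ 2 + ((1 - 2 / k) * (n * p n ^ 4) + 2 * p n ^ 4)) := by ring
    have h5 : ((n : ℝ) - k) ^ 2 = n ^ 2 * (1 - k / n) ^ 2 := by
      field_simp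
    rw [h4, Real.exp_add, h5]
    ring
  have hlim := (hm.inv₀ (Real.exp_pos c).ne').add hδ
  rw [add_zero, ← Real.exp_neg] at hlim
  have hlt : Real.exp (-c) < (1 + ε) * Real.exp (-c) := by
    have := Real.exp_pos (-c)
    nlinarith
  obtain ⟨N, hN⟩ := Filter.eventually_atTop.1 ((hlim.eventually_lt_const hlt).and
    ((hpt.eventually_le_const (show (0 : ℝ) < 1 / 2 by norm_num)).and
      (Filter.eventually_gt_atTop k)))
  refine ⟨N, fun n hn => ?_⟩
  obtain ⟨h1, h2, h3⟩ := hN n hn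
  exact (turanKpartiteDiam2Prob_le_exp (hp0 n) h2 (by omega) h3).trans h1.le
end
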